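/- Let Ḡ denote the closure of the subgroup ⟨a, b⟩ (the iterated monodromy group IMG(T_d), d ≥ 2) in the homeomorphism group of X = (Fin d)^ℕ with respect to the topology of uniform convergence. Then the action of Ḡ on X is locally quasi-analytic, and for every x ∈ X the stabilizer {g ∈ Ḡ : g(x) = x} has exactly two elements. (Thus the action of IMG(T_d) is stable with discriminant group ℤ/2ℤ.) -/

import Mathlib

open UniformConvergence

/-- The group of self-homeomorphisms of a topological space, with composition
`(f * g) x = f (g x)`. -/
instance homeoGroup {X : Type*} [TopologicalSpace X] : Group (X ≃ₜ X) where
  mul f g := g.trans f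
  one := Homeomorph.refl X
  inv := Homeomorph.symm
  mul_assoc _ _ _ := Homeomorph.ext fun _ => rfl
  one_mul _ := Homeomorph.ext fun _ => rfl
  mul_one _ := Homeomorph.ext fun _ => rfl
  inv_mul_cancel f := Homeomorph.ext f.symm_apply_apply

/-- The standard metric on the space of sequences `(Fin d)^ℕ`, inducing the product
topology. -/
noncomputable instance piFinMetric (d : ℕ) : MetricSpace (ℕ → Fin d) :=
  PiNat.metricSpace

/-- Prepend the letter `v` to the sequence `x`. -/
def cons {d : ℕ} (v : Fin d) (x : ℕ → Fin d) : ℕ → Fin d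
  | 0 => v
  | n + 1 => x n

/-- The permutation `τ` of `{0,…,d-1}`: the product of the transpositions
`(0 1)(2 3)⋯` of consecutive pairs (the last letter is fixed when `d` is odd). -/
def tauPerm (d : ℕ) (v : Fin d) : Fin d :=
  if (v : ℕ) % 2 = 0 then
    (if h : (v : ℕ) + 1 < d then ⟨(v : ℕ) + 1, h⟩ else v)
  else ⟨(v : ℕ) - 1, lt_of_le_of_lt (Nat.sub_le _ _) v.isLt⟩

/-- The permutation `σ` of `{0,…,d-1}`: the product of the transpositions
`(1 2)(3 4)⋯` of consecutive pairs starting from `1` (the last letter is fixed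
when `d` is even; `0` is always fixed). -/
def sigmaPerm (d : ℕ) (v : Fin d) : Fin d :=
  if (v : ℕ) = 0 then v
  else if (v : ℕ) % 2 = 1 then
    (if h : (v : ℕ) + 1 < d then ⟨(v : ℕ) + 1, h⟩ else v)
  else ⟨(v : ℕ) - 1, lt_of_le_of_lt (Nat.sub_le _ _) v.isLt⟩

/-- The recursive equations defining the generators `a`, `b` of the iterated monodromy
group of the degree-`d` Chebyshev polynomial, acting on `X = (Fin d)^ℕ`. -/
def ChebRec (d : ℕ) (a b : (ℕ → Fin d) → (ℕ → Fin d)) : Prop :=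
  (Even d →
    (∀ (v : Fin d) (w : ℕ → Fin d), a (cons v w) = cons (tauPerm d v) w) ∧
    (∀ (v : Fin d) (w : ℕ → Fin d), (v : ℕ) = 0 → b (cons v w) = cons v (b w)) ∧
    (∀ (v : Fin d) (w : ℕ → Fin d), (v : ℕ) = d - 1 → b (cons v w) = cons v (a w)) ∧
    (∀ (v : Fin d) (w : ℕ → Fin d), 0 < (v : ℕ) → (v : ℕ) < d - 1 →
      b (cons v w) = cons (sigmaPerm d v) w)) ∧
  (¬ Even d →
    (∀ (v : Fin d) (w : ℕ → Fin d), (v : ℕ) ≠ d - 1 → a (cons v w) = cons (tauPerm d v) w) ∧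
    (∀ (v : Fin d) (w : ℕ → Fin d), (v : ℕ) = d - 1 → a (cons v w) = cons v (a w)) ∧
    (∀ (v : Fin d) (w : ℕ → Fin d), (v : ℕ) = 0 → b (cons v w) = cons v (b w)) ∧
    (∀ (v : Fin d) (w : ℕ → Fin d), (v : ℕ) ≠ 0 → b (cons v w) = cons (sigmaPerm d v) w))

/-- An action of a family `Γ` of self-maps of a metric space `X` is locally quasi-analytic
if there is `ε > 0` such that for every open set `U` of diameter less than `ε`,
any two elements of `Γ` that agree on a nonempty open subset `V ⊆ U` agree on all of `U`. -/
def IsLocallyQuasiAnalytic {X : Type*} [MetricSpace X] (Γ : Set (X → X)) : Prop :=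
  ∃ ε > (0 : ℝ), ∀ U : Set X, IsOpen U → Metric.diam U < ε →
    ∀ g₁ ∈ Γ, ∀ g₂ ∈ Γ, ∀ V : Set X, V ⊆ U → IsOpen V → V.Nonempty →
      Set.EqOn g₁ g₂ V → Set.EqOn g₁ g₂ U

namespace Cheb

variable {d : ℕ}

/-- coding of letters -/
def f (v : ℕ) : ℤ := if v % 2 = 0 then (v : ℤ) / 2 else -((v : ℤ) + 1) / 2
def s (v : ℕ) : ℤ := if v % 2 = 0 then 1 else -1

/-- the shift map -/
def sh (x : ℕ → Fin d) : ℕ → Fin d := fun n => x (n + 1)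

/-- `d`-adic coding truncated at level `n` -/
def phi : ℕ → (ℕ → Fin d) → ℤ
  | 0, _ => 0
  | n + 1, x => f (x 0) + s (x 0) * (d * phi n (sh x))

theorem me_of_eq {n a b : ℤ} (h : a = b) : a ≡ b [ZMOD n] := by rw [h]

theorem cons_sh (x : ℕ → Fin d) : cons (x 0) (sh x) = x := by
  funext n; cases n <;> rfl

theorem phi_cons (n : ℕ) (v : Fin d) (w : ℕ → Fin d) :
    phi (n + 1) (cons v w) = f v + s v * (d * phi n w) := rfl

theorem s_cases (v : ℕ) : s v = 1 ∨ s v = -1 := by unfold s; split <;> simp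

theorem modEq_lift {n : ℕ} {a b c e : ℤ} (h : a ≡ b [ZMOD (d : ℤ) ^ n]) (u : ℤ)
    (h1 : c - e = u * (d * (a - b))) : c ≡ e [ZMOD (d : ℤ) ^ (n + 1)] := by
  apply Int.ModEq.symm
  rw [Int.modEq_iff_dvd, h1, pow_succ']
  exact Dvd.dvd.mul_left (mul_dvd_mul_left _ (Int.modEq_iff_dvd.1 h.symm)) _

theorem f_inj {v w : ℕ} (hv : v < d) (hw : w < d) (h : (d : ℤ) ∣ f v - f w) : v = w := by
  have h0 : f v - f w = 0 := by
    apply Int.eq_zero_of_abs_lt_dvd h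
    rw [abs_lt]; unfold f; split <;> split <;> omega
  unfold f at h0; split at h0 <;> split at h0 <;> omega

theorem phi_modEq_iff (n : ℕ) : ∀ (x y : ℕ → Fin d),
    phi n x ≡ phi n y [ZMOD (d : ℤ) ^ n] ↔ ∀ i < n, x i = y i := by
  induction n with
  | zero => intro x y; simp [Int.modEq_one]
  | succ n ih =>
    intro x y
    constructor
    · intro h
      have h0 : x 0 = y 0 := by
        apply Fin.ext
        apply f_inj (x 0).isLt (y 0).isLt
        have h2 : (d : ℤ) ∣ phi (n + 1) x - phi (n + 1) y :=
          (dvd_pow_self _ (Nat.succ_ne_zero n)).trans (Int.modEq_iff_dvd.1 h.symm)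
        have h3 : f (x 0) - f (y 0) = (phi (n + 1) x - phi (n + 1) y)
            - d * (s (x 0) * phi n (sh x) - s (y 0) * phi n (sh y)) := by
          simp only [phi]; ring
        rw [h3]
        exact dvd_sub h2 (dvd_mul_right _ _)
      have h1 : phi n (sh x) ≡ phi n (sh y) [ZMOD (d : ℤ) ^ n] := by
        have h2 := Int.modEq_iff_dvd.1 h
        have h3 : phi (n + 1) y - phi (n + 1) x
            = s (x 0) * (d * (phi n (sh y) - phi n (sh x))) := by
          simp only [phi, h0]; ring
        have hd0 : (d : ℤ) ≠ 0 := by have := (x 0).pos; omega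
        rw [h3, pow_succ'] at h2
        rw [Int.modEq_iff_dvd]
        rcases s_cases (x 0) with hs | hs <;> rw [hs] at h2
        · rw [one_mul] at h2
          exact Int.dvd_of_mul_dvd_mul_left hd0 h2
        · rw [neg_one_mul, dvd_neg] at h2
          exact Int.dvd_of_mul_dvd_mul_left hd0 h2
      intro i hi
      cases i with
      | zero => exact h0
      | succ i => exact (ih _ _).1 h1 i (by omega)
    · intro h
      have h0 := h 0 (by omega)
      have h1 := (ih (sh x) (sh y)).2 (fun i hi => h (i + 1) (by omega))
      apply modEq_lift h1 (s (x 0))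
      simp only [phi, h0]; ring

theorem phi_succ (n : ℕ) : ∀ x : ℕ → Fin d, phi (n + 1) x ≡ phi n x [ZMOD (d : ℤ) ^ n] := by
  induction n with
  | zero => intro x; simp [Int.modEq_one]
  | succ n ih =>
    intro x
    apply modEq_lift (ih (sh x)) (s (x 0))
    rw [phi]; simp only [phi]; ring

theorem phi_le {m n : ℕ} (h : m ≤ n) (x : ℕ → Fin d) :
    phi n x ≡ phi m x [ZMOD (d : ℤ) ^ m] := by
  induction n, h using Nat.le_induction with
  | base => rfl
  | succ n h ih => exact ((phi_succ n x).of_dvd (pow_dvd_pow _ h)).trans ih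

theorem f_even {k : ℕ} : f (2 * k) = k ∧ s (2 * k) = 1 := by
  unfold f s; rw [if_pos (by omega), if_pos (by omega)]; constructor <;> push_cast <;> omega

theorem f_odd {k : ℕ} : f (2 * k + 1) = -1 - k ∧ s (2 * k + 1) = -1 := by
  unfold f s; rw [if_neg (by omega), if_neg (by omega)]; constructor <;> push_cast <;> omega

theorem f_tau (v : Fin d) (h : (v : ℕ) % 2 = 0 → (v : ℕ) + 1 < d) :
    f (tauPerm d v) = -1 - f v ∧ s (tauPerm d v) = - s v := by
  rcases Nat.even_or_odd' (v : ℕ) with ⟨k, hk | hk⟩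
  · have h1 : ((tauPerm d v : Fin d) : ℕ) = 2 * k + 1 := by
      unfold tauPerm; rw [if_pos (by omega), dif_pos (h (by omega))]; simp [hk]
    rw [h1, hk, f_even.1, f_even.2, f_odd.1, f_odd.2]; simp
  · have h1 : ((tauPerm d v : Fin d) : ℕ) = 2 * k := by
      unfold tauPerm; rw [if_neg (by omega)]; simp [hk]
    rw [h1, hk, f_even.1, f_even.2, f_odd.1, f_odd.2]; simp

theorem f_sigma (v : Fin d) (h' : (v : ℕ) ≠ 0) (h : (v : ℕ) % 2 = 1 → (v : ℕ) + 1 < d) :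
    f (sigmaPerm d v) = - f v ∧ s (sigmaPerm d v) = - s v := by
  rcases Nat.even_or_odd' (v : ℕ) with ⟨k, hk | hk⟩
  · obtain ⟨j, rfl⟩ : ∃ j, k = j + 1 := ⟨k - 1, by omega⟩
    have h1 : ((sigmaPerm d v : Fin d) : ℕ) = 2 * j + 1 := by
      unfold sigmaPerm; rw [if_neg h', if_neg (by omega)]; simp [hk]; omega
    rw [h1, hk, f_even.1, f_even.2, f_odd.1, f_odd.2]; simp; ring
  · have h1 : ((sigmaPerm d v : Fin d) : ℕ) = 2 * (k + 1) := by
      unfold sigmaPerm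
      rw [if_neg h', if_pos (by omega), dif_pos (h (by omega))]; simp [hk]; ring
    rw [h1, hk, f_even.1, f_even.2, f_odd.1, f_odd.2]; simp

theorem phi_AB (a b : (ℕ → Fin d) → (ℕ → Fin d)) (hab : ChebRec d a b) (n : ℕ) :
    (∀ x, phi n (a x) ≡ -1 - phi n x [ZMOD (d : ℤ) ^ n]) ∧
    (∀ x, phi n (b x) ≡ - phi n x [ZMOD (d : ℤ) ^ n]) := by
  induction n with
  | zero => simp [Int.modEq_one]
  | succ n ih =>
    obtain ⟨ihA, ihB⟩ := ih
    have key : ∀ v : Fin d, ∀ w,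
        phi (n + 1) (a (cons v w)) ≡ -1 - phi (n + 1) (cons v w) [ZMOD (d : ℤ) ^ (n + 1)] ∧
        phi (n + 1) (b (cons v w)) ≡ - phi (n + 1) (cons v w) [ZMOD (d : ℤ) ^ (n + 1)] := by
      intro v w
      have hv := v.isLt
      by_cases he : Even d
      · obtain ⟨h1, h2, h3, h4⟩ := hab.1 he
        rw [Nat.even_iff] at he
        constructor
        · obtain ⟨e1, e2⟩ := f_tau v (by omega)
          rw [h1, phi_cons, phi_cons, e1, e2]
          apply me_of_eq; ring
        · by_cases hv0 : (v : ℕ) = 0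
          · rw [h2 v w hv0, phi_cons, phi_cons]
            apply modEq_lift (ihB w) (s v)
            simp only [hv0, f, s]; norm_num; ring
          · by_cases hv1 : (v : ℕ) = d - 1
            · rw [h3 v w hv1, phi_cons, phi_cons]
              have hs : s v = -1 := by unfold s; rw [if_neg (by omega)]
              have hf : 2 * f v = -d := by
                unfold f; rw [if_neg (by omega)]; omega
              apply modEq_lift (ihA w) (s v)
              rw [hs]; linear_combination hf
            · obtain ⟨e1, e2⟩ := f_sigma v hv0 (by omega)
              rw [h4 v w (by omega) (by omega), phi_cons, phi_cons, e1, e2]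
              apply me_of_eq; ring
      · obtain ⟨h1, h2, h3, h4⟩ := hab.2 he
        rw [Nat.even_iff] at he
        constructor
        · by_cases hv1 : (v : ℕ) = d - 1
          · rw [h2 v w hv1, phi_cons, phi_cons]
            have hs : s v = 1 := by unfold s; rw [if_pos (by omega)]
            have hf : 2 * f v = d - 1 := by
              unfold f; rw [if_pos (by omega)]; omega
            apply modEq_lift (ihA w) (s v)
            rw [hs]; linear_combination hf
          · obtain ⟨e1, e2⟩ := f_tau v (by omega)
            rw [h1 v w hv1, phi_cons, phi_cons, e1, e2]
            apply me_of_eq; ring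
        · by_cases hv0 : (v : ℕ) = 0
          · rw [h3 v w hv0, phi_cons, phi_cons]
            apply modEq_lift (ihB w) (s v)
            simp only [hv0, f, s]; norm_num; ring
          · obtain ⟨e1, e2⟩ := f_sigma v hv0 (by omega)
            rw [h4 v w hv0, phi_cons, phi_cons, e1, e2]
            apply me_of_eq; ring
    constructor
    · intro x; have := (key (x 0) (sh x)).1; rwa [cons_sh] at this
    · intro x; have := (key (x 0) (sh x)).2; rwa [cons_sh] at this

/-- `g` acts as the affine map `t ↦ e t + c` on level `n`. -/
def Aff (n : ℕ) (e c : ℤ) (g : (ℕ → Fin d) → (ℕ → Fin d)) : Prop :=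
  ∀ x, phi n (g x) ≡ e * phi n x + c [ZMOD (d : ℤ) ^ n]

/-- agreement on the first `n` letters -/
def Agree (n : ℕ) (g h : (ℕ → Fin d) → (ℕ → Fin d)) : Prop :=
  ∀ x, ∀ i < n, g x i = h x i

theorem Agree.mono {m n : ℕ} (hmn : m ≤ n) {g h : (ℕ → Fin d) → (ℕ → Fin d)}
    (H : Agree n g h) : Agree m g h := fun x i hi => H x i (by omega)

theorem eq_of_agree {g h : (ℕ → Fin d) → (ℕ → Fin d)} (m : ℕ)
    (H : ∀ n, m ≤ n → Agree n g h) : g = h := by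
  funext x i
  exact H (max m (i + 1)) (le_max_left _ _) x i (by omega)

theorem Aff.congr {n : ℕ} {e c : ℤ} {g h : (ℕ → Fin d) → (ℕ → Fin d)} (H : Aff n e c h)
    (hg : Agree n g h) : Aff n e c g := fun x =>
  ((phi_modEq_iff n _ _).2 (hg x)).trans (H x)

theorem Aff.agree {n : ℕ} {e c c' : ℤ} {g h : (ℕ → Fin d) → (ℕ → Fin d)} (H : Aff n e c g)
    (H' : Aff n e c' h) (hc : c ≡ c' [ZMOD (d : ℤ) ^ n]) : Agree n g h := fun x =>
  (phi_modEq_iff n _ _).1 ((H x).trans (((Int.ModEq.refl _).add hc).trans (H' x).symm))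

theorem group_aff (A B : (ℕ → Fin d) ≃ₜ (ℕ → Fin d)) (hab : ChebRec d ⇑A ⇑B)
    (g : (ℕ → Fin d) ≃ₜ (ℕ → Fin d)) (hg : g ∈ Subgroup.closure {A, B}) :
    ∃ e c : ℤ, (e = 1 ∨ e = -1) ∧ ∀ n, Aff n e c g := by
  induction hg using Subgroup.closure_induction with
  | mem x hx =>
    rcases hx with rfl | hx
    · refine ⟨-1, -1, Or.inr rfl, fun n y => ?_⟩
      convert (phi_AB _ _ hab n).1 y using 1; ring
    · rw [Set.mem_singleton_iff] at hx; subst hx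
      refine ⟨-1, 0, Or.inr rfl, fun n y => ?_⟩
      convert (phi_AB _ _ hab n).2 y using 1; ring
  | one => exact ⟨1, 0, Or.inl rfl, fun n y => by
      have : (1 : (ℕ → Fin d) ≃ₜ (ℕ → Fin d)) y = y := rfl
      rw [this]; apply me_of_eq; ring⟩
  | mul x y _ _ hx hy =>
    obtain ⟨e, c, he, hx⟩ := hx
    obtain ⟨e', c', he', hy⟩ := hy
    refine ⟨e * e', e * c' + c, ?_, fun n z => ?_⟩
    · rcases he with rfl | rfl <;> rcases he' with rfl | rfl <;> simp
    · have : (x * y) z = x (y z) := rfl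
      rw [this]
      refine (hx n _).trans ((((hy n z).mul_left e).add_right c).trans (me_of_eq (by ring)))
  | inv x _ hx =>
    obtain ⟨e, c, he, hx⟩ := hx
    refine ⟨e, -(e * c), he, fun n z => ?_⟩
    have h1 := hx n (x⁻¹ z)
    have h2 : x (x⁻¹ z) = z := x.apply_symm_apply z
    rw [h2] at h1
    have hee : e * e = 1 := by rcases he with rfl | rfl <;> simp
    have h3 := (h1.mul_left e).add_right (-(e * c))
    refine Int.ModEq.symm (h3.trans (me_of_eq ?_))
    linear_combination (phi n (x⁻¹ z)) * hee

theorem group_refl (A B : (ℕ → Fin d) ≃ₜ (ℕ → Fin d)) (hab : ChebRec d ⇑A ⇑B) (c : ℤ) :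
    ∃ g ∈ Subgroup.closure {A, B}, ∀ n, Aff n (-1) c (g : (ℕ → Fin d) ≃ₜ (ℕ → Fin d)) := by
  have hA : A ∈ Subgroup.closure {A, B} := Subgroup.subset_closure (by simp)
  have hB : B ∈ Subgroup.closure {A, B} := Subgroup.subset_closure (by simp)
  induction c using Int.induction_on with
  | zero =>
    refine ⟨B, hB, fun n y => ?_⟩
    convert (phi_AB _ _ hab n).2 y using 1; ring
  | succ i ih =>
    obtain ⟨g, hg, H⟩ := ih
    refine ⟨B * A * g, mul_mem (mul_mem hB hA) hg, fun n y => ?_⟩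
    have : (B * A * g) y = B (A (g y)) := rfl
    rw [this]
    have h1 := (phi_AB _ _ hab n).2 (A (g y))
    have h2 := ((phi_AB _ _ hab n).1 (g y)).neg
    have h3 := (H n y).add_left 1
    exact h1.trans (h2.trans ((me_of_eq (by ring)).trans
      (h3.trans (me_of_eq (by ring)))))
  | pred i ih =>
    obtain ⟨g, hg, H⟩ := ih
    refine ⟨A * B * g, mul_mem (mul_mem hA hB) hg, fun n y => ?_⟩
    have : (A * B * g) y = A (B (g y)) := rfl
    rw [this]
    have h1 := (phi_AB _ _ hab n).1 (B (g y))
    have h2 := ((phi_AB _ _ hab n).2 (g y)).neg.add_left (-1)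
    have h3 := (H n y).add_left (-1)
    exact h1.trans ((me_of_eq (by ring)).trans (h2.trans ((me_of_eq (by ring)).trans
      (h3.trans (me_of_eq (by ring))))))

/-- The closure in the statement. -/
abbrev Gbar (A B : (ℕ → Fin d) ≃ₜ (ℕ → Fin d)) : Set ((ℕ → Fin d) →ᵤ (ℕ → Fin d)) :=
  closure (UniformFun.ofFun ''
          ((fun g : (ℕ → Fin d) ≃ₜ (ℕ → Fin d) => ⇑g) ''
            ((Subgroup.closure {A, B} : Subgroup ((ℕ → Fin d) ≃ₜ (ℕ → Fin d))) :
              Set ((ℕ → Fin d) ≃ₜ (ℕ → Fin d)))))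

theorem mem_Gbar (A B : (ℕ → Fin d) ≃ₜ (ℕ → Fin d)) (g : (ℕ → Fin d) →ᵤ (ℕ → Fin d)) :
    g ∈ Gbar A B ↔ ∀ n, ∃ h ∈ Subgroup.closure {A, B}, Agree n (UniformFun.toFun g) ⇑h := by
  have hb := UniformFun.hasBasis_nhds_of_basis (ℕ → Fin d) (ℕ → Fin d) g
    (Metric.uniformity_basis_dist_le_pow (α := ℕ → Fin d) (r := 1 / 2) (by norm_num) (by norm_num))
  rw [mem_closure_iff_nhds_basis hb]
  simp only [true_implies, Set.exists_mem_image, SetLike.mem_coe]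
  refine forall_congr' fun n => exists_congr fun h => and_congr_right fun _ => ?_
  refine forall_congr' fun x => ?_
  exact PiNat.mem_cylinder_iff_dist_le.symm

theorem Gbar_aff {A B : (ℕ → Fin d) ≃ₜ (ℕ → Fin d)} (hab : ChebRec d ⇑A ⇑B)
    {g : (ℕ → Fin d) →ᵤ (ℕ → Fin d)} (hg : g ∈ Gbar A B) (n : ℕ) :
    ∃ e c : ℤ, (e = 1 ∨ e = -1) ∧ Aff n e c (UniformFun.toFun g) := by
  obtain ⟨h, hh, H⟩ := (mem_Gbar A B g).1 hg n
  obtain ⟨e, c, he, H'⟩ := group_aff A B hab h hh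
  exact ⟨e, c, he, (H' n).congr H⟩

theorem no_two_torsion {x y : ℕ → Fin d} (hxy : x ≠ y) :
    ∃ m, ∀ n, m ≤ n → ¬ 2 * phi n x ≡ 2 * phi n y [ZMOD (d : ℤ) ^ n] := by
  obtain ⟨i, hi⟩ := Function.ne_iff.1 hxy
  refine ⟨i + 2, fun n hn h => hi ?_⟩
  have hd0 : (d : ℤ) ≠ 0 := by have := (x 0).pos; omega
  have h1 := Int.modEq_iff_dvd.1 (h.of_dvd (pow_dvd_pow _ hn))
  have h2 : phi n x ≡ phi n y [ZMOD (d : ℤ) ^ (i + 1)] := by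
    rw [Int.modEq_iff_dvd]
    rw [← mul_sub] at h1
    rcases Int.even_or_odd (d : ℤ) with he | ho
    · obtain ⟨k, hk⟩ := he.two_dvd
      have h3 : (d : ℤ) ^ (i + 2) = 2 * (d ^ (i + 1) * k) := by
        rw [pow_succ _ (i + 1)]; nth_rewrite 2 [hk]; ring
      rw [h3] at h1
      exact (dvd_mul_right _ _).trans (Int.dvd_of_mul_dvd_mul_left (by norm_num) h1)
    · have hc : IsCoprime ((d : ℤ) ^ (i + 2)) 2 :=
        by
        obtain ⟨k, hk⟩ := ho
        exact IsCoprime.pow_left ⟨1, -k, by rw [hk]; ring⟩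
      exact (pow_dvd_pow _ (by omega)).trans (hc.dvd_of_dvd_mul_left h1)
  have h3 := (phi_le (by omega : i + 1 ≤ n) x).symm.trans (h2.trans (phi_le (by omega) y))
  exact (phi_modEq_iff _ _ _).1 h3 i (by omega)

theorem Gbar_unique {A B : (ℕ → Fin d) ≃ₜ (ℕ → Fin d)} (hab : ChebRec d ⇑A ⇑B)
    {g h : (ℕ → Fin d) →ᵤ (ℕ → Fin d)} (hg : g ∈ Gbar A B) (hh : h ∈ Gbar A B)
    {x y : ℕ → Fin d} (hxy : x ≠ y) (hx : UniformFun.toFun g x = UniformFun.toFun h x)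
    (hy : UniformFun.toFun g y = UniformFun.toFun h y) :
    UniformFun.toFun g = UniformFun.toFun h := by
  obtain ⟨m, hm⟩ := no_two_torsion hxy
  refine eq_of_agree m fun n hn => ?_
  obtain ⟨e, c, he, H⟩ := Gbar_aff hab hg n
  obtain ⟨e', c', he', H'⟩ := Gbar_aff hab hh n
  have h1 := H x
  have h2 := H y
  rw [hx] at h1
  rw [hy] at h2
  have h1 := h1.symm.trans (H' x)
  have h2 := h2.symm.trans (H' y)
  by_cases hee : e = e'
  · subst hee
    exact H.agree H' (Int.ModEq.add_left_cancel' _ h1)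
  · exfalso
    apply hm n hn
    have h3 := h1.sub h2
    rcases he with rfl | rfl <;> rcases he' with rfl | rfl
    · exact absurd rfl hee
    · have h4 := h3.add_right (phi n x + phi n y)
      ring_nf at h4
      rwa [mul_comm, mul_comm _ (2 : ℤ)] at h4
    · have h4 := h3.add_right (phi n x + phi n y)
      ring_nf at h4
      rw [mul_comm, mul_comm _ (2 : ℤ)] at h4
      exact h4.symm
    · exact absurd rfl hee

theorem exists_refl {A B : (ℕ → Fin d) ≃ₜ (ℕ → Fin d)} (hab : ChebRec d ⇑A ⇑B)
    (x : ℕ → Fin d) : ∃ r : (ℕ → Fin d) →ᵤ (ℕ → Fin d), r ∈ Gbar A B ∧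
      ∀ n, Aff n (-1) (2 * phi n x) (UniformFun.toFun r) := by
  choose h hh H using fun n => group_refl A B hab (2 * phi n x)
  have hr : ∀ n, Agree n (fun y k => h (k + 1) y k) (h n) := by
    intro n y i hi
    exact Aff.agree (H (i + 1) (i + 1)) (H n (i + 1))
      ((phi_le (by omega : i + 1 ≤ n) x).symm.mul_left 2) y i (by omega)
  refine ⟨UniformFun.ofFun (fun y k => h (k + 1) y k), ?_, fun n => ?_⟩
  · rw [mem_Gbar]
    exact fun n => ⟨h n, hh n, hr n⟩
  · exact (H n n).congr (hr n)

theorem stab {A B : (ℕ → Fin d) ≃ₜ (ℕ → Fin d)} (hd : 2 ≤ d) (hab : ChebRec d ⇑A ⇑B)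
    (x : ℕ → Fin d) : {g ∈ Gbar A B | UniformFun.toFun g x = x}.ncard = 2 := by
  obtain ⟨r, hr, Hr⟩ := exists_refl hab x
  have hid : Gbar A B (UniformFun.ofFun id) :=
    (mem_Gbar _ _ _).2 fun n => ⟨1, one_mem _, fun x i _ => rfl⟩
  have Hid : ∀ n, Aff n 1 0 (id : (ℕ → Fin d) → (ℕ → Fin d)) := fun n y =>
    me_of_eq (by simp)
  rw [Set.ncard_eq_two]
  refine ⟨UniformFun.ofFun id, r, ?_, ?_⟩
  · intro hne
    have : Nontrivial (Fin d) := Fin.nontrivial_iff_two_le.2 hd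
    obtain ⟨y, hy⟩ := exists_ne x
    obtain ⟨m, hm⟩ := no_two_torsion hy
    apply hm m le_rfl
    have h1 := Hr m y
    rw [← hne] at h1
    have h2 : phi m y ≡ -1 * phi m y + 2 * phi m x [ZMOD (d : ℤ) ^ m] := h1
    have h3 := h2.add_left (phi m y)
    exact (me_of_eq (by ring)).trans (h3.trans (me_of_eq (by ring)))
  · ext g
    simp only [Set.mem_ofPred_eq, Set.mem_insert_iff, Set.mem_singleton_iff]
    constructor
    · rintro ⟨hg, hgx⟩
      by_contra hcon
      push Not at hcon
      have hlev : ∀ n, Agree n (UniformFun.toFun g) id ∨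
          Agree n (UniformFun.toFun g) (UniformFun.toFun r) := by
        intro n
        obtain ⟨e, c, he, H⟩ := Gbar_aff hab hg n
        have h1 := H x
        rw [hgx] at h1
        rcases he with rfl | rfl
        · left
          refine H.agree (Hid n) ?_
          have h2 := h1.add_left (- phi n x)
          ring_nf at h2
          exact h2.symm
        · right
          refine H.agree (Hr n) ?_
          have h2 := h1.add_left (phi n x)
          exact ((me_of_eq (by ring)).trans (h2.trans (me_of_eq (by ring)))).symm
      by_cases hall : ∀ n, Agree n (UniformFun.toFun g) id
      · exact hcon.1 (eq_of_agree 0 fun n _ => hall n)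
      · push Not at hall
        obtain ⟨m, hm⟩ := hall
        exact hcon.2 (eq_of_agree m fun n hn =>
          (hlev n).resolve_left fun h => hm (h.mono hn))
    · rintro (rfl | rfl)
      · exact ⟨hid, rfl⟩
      · refine ⟨hr, ?_⟩
        funext i
        refine (phi_modEq_iff (i + 1) _ _).1 ((Hr (i + 1) x).trans (me_of_eq ?_)) i
          (by omega)
        ring

theorem lqa {A B : (ℕ → Fin d) ≃ₜ (ℕ → Fin d)} (hd : 2 ≤ d) (hab : ChebRec d ⇑A ⇑B) :
    IsLocallyQuasiAnalytic
      ((fun g : (ℕ → Fin d) →ᵤ (ℕ → Fin d) => (UniformFun.toFun g : (ℕ → Fin d) → ℕ → Fin d)) ''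
        Gbar A B) := by
  refine ⟨1, one_pos, ?_⟩
  rintro U _ _ _ ⟨g, hg, rfl⟩ _ ⟨h, hh, rfl⟩ V _ hV ⟨x, hx⟩ hE
  have : Nontrivial (Fin d) := Fin.nontrivial_iff_two_le.2 hd
  obtain ⟨ε, hε, hball⟩ := Metric.isOpen_iff.1 hV x hx
  obtain ⟨n, hn⟩ := exists_pow_lt_of_lt_one hε (by norm_num : (1 / 2 : ℝ) < 1)
  obtain ⟨v, hv⟩ := exists_ne (x n)
  have hy : Function.update x n v ∈ V := by
    apply hball
    rw [Metric.mem_ball]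
    exact lt_of_le_of_lt
      (PiNat.mem_cylinder_iff_dist_le.1 (PiNat.update_mem_cylinder x n v)) hn
  have hne : x ≠ Function.update x n v := fun hc => hv (by
    have := congrFun hc n
    simpa using this.symm)
  have := Gbar_unique hab hg hh hne (hE hx) (hE hy)
  intro z _
  exact congrFun this z

end Cheb

/-- The closure `Ḡ` of `IMG(T_d) = ⟨a, b⟩` in the homeomorphism group of `X = (Fin d)^ℕ`,
taken with respect to the topology of uniform convergence, acts locally quasi-analytically
on `X` and every point stabilizer in `Ḡ` has exactly two elements (the action of `IMG(T_d)`
is stable with discriminant group `ℤ/2ℤ`). -/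
theorem stmt6 (d : ℕ) (hd : 2 ≤ d)
    (A B : (ℕ → Fin d) ≃ₜ (ℕ → Fin d)) (hab : ChebRec d ⇑A ⇑B) :
    IsLocallyQuasiAnalytic
      ((fun g : (ℕ → Fin d) →ᵤ (ℕ → Fin d) => (UniformFun.toFun g : (ℕ → Fin d) → ℕ → Fin d)) ''
        closure (UniformFun.ofFun ''
          ((fun g : (ℕ → Fin d) ≃ₜ (ℕ → Fin d) => ⇑g) ''
            ((Subgroup.closure {A, B} : Subgroup ((ℕ → Fin d) ≃ₜ (ℕ → Fin d))) :
              Set ((ℕ → Fin d) ≃ₜ (ℕ → Fin d)))))) ∧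
    ∀ x : ℕ → Fin d,
      {g ∈ closure (UniformFun.ofFun ''
          ((fun g : (ℕ → Fin d) ≃ₜ (ℕ → Fin d) => ⇑g) ''
            ((Subgroup.closure {A, B} : Subgroup ((ℕ → Fin d) ≃ₜ (ℕ → Fin d))) :
              Set ((ℕ → Fin d) ≃ₜ (ℕ → Fin d))))) |
        UniformFun.toFun g x = x}.ncard = 2 := by
  exact ⟨Cheb.lqa hd hab, fun x => Cheb.stab hd hab x⟩
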